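/- arXiv:2411.06370 — 7 statements merged into one kernel-verified Lean document; each statement's English description precedes it below -/
import Mathlib

section
/- Let 𝒰 be a finite set and let S : Set 𝒰 → Σ be a composable sketching map. If U₁ ⊆ U₂ ⊆ U₃ ⊆ 𝒰 and S(U₁) = S(U₃), then S(U₂) = S(U₁) = S(U₃). -/
/-- A sketching map `S` on ground set `𝒰` is *composable* if there is a binary
operation `op` on sketch values with `S (A ∪ B) = op (S A) (S B)` for all `A B`. -/
def Composable {𝒰 T : Type*} (S : Set 𝒰 → T) : Prop :=
  ∃ op : T → T → T, ∀ A B : Set 𝒰, S (A ∪ B) = op (S A) (S B)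

/-- Midpoint property: if `U₁ ⊆ U₂ ⊆ U₃` and `S U₁ = S U₃`, then
`S U₂ = S U₁ = S U₃`. -/
theorem stmt0 {𝒰 T : Type*} [Fintype 𝒰] (S : Set 𝒰 → T) (hS : Composable S)
    (U₁ U₂ U₃ : Set 𝒰) (h12 : U₁ ⊆ U₂) (h23 : U₂ ⊆ U₃) (h13 : S U₁ = S U₃) :
    S U₂ = S U₁ ∧ S U₂ = S U₃ := by
  obtain ⟨op, hop⟩ := hS
  have h : S U₂ = S U₃ := by
    calc S U₂ = S (U₁ ∪ U₂) := by rw [Set.union_eq_self_of_subset_left h12]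
      _ = S (U₃ ∪ U₂) := by rw [hop, h13, ← hop]
      _ = S U₃ := by rw [Set.union_eq_self_of_subset_right h23]
  exact ⟨h.trans h13.symm, h⟩
end

section
/- Let 𝒰 be a finite set and let S : Set 𝒰 → Σ be a composable sketching map. If U ⊆ V ⊆ 𝒰, then MaxSet(S(U)) ⊆ MaxSet(S(V)). -/
/-- `MaxSet S σ` is the union of all subsets whose sketch equals `σ`. -/
def MaxSet {𝒰 T : Type*} (S : Set 𝒰 → T) (σ : T) : Set 𝒰 :=
  ⋃₀ {A : Set 𝒰 | S A = σ}

/-- Containment order implies sketch order: `U ⊆ V → MaxSet (S U) ⊆ MaxSet (S V)`. -/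
theorem stmt2 {𝒰 T : Type*} [Fintype 𝒰] (S : Set 𝒰 → T) (hS : Composable S)
    (U V : Set 𝒰) (hUV : U ⊆ V) :
    MaxSet S (S U) ⊆ MaxSet S (S V) := by
  obtain ⟨op, hop⟩ := hS
  rintro x ⟨A, hA : S A = S U, hxA⟩
  have hAV : S (A ∪ V) = S V := by
    rw [hop, hA, ← hop, Set.union_eq_self_of_subset_left hUV]
  exact ⟨A ∪ V, hAV, Or.inl hxA⟩
end

section
/- Let 𝒰 be a finite set and let S : Set 𝒰 → Σ be a composable sketching map, and let σ = S(U₀) for some U₀ ⊆ 𝒰. Then for every U ⊆ 𝒰: S(U) = σ if and only if there exists a core C of σ with C ⊆ U ⊆ MaxSet(σ). In particular, every U ⊆ 𝒰 contains a core of S(U). -/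
/-- `C` is a *core* of the sketch value `σ`: `S C = σ` and no proper subset of
`C` has sketch `σ`. -/
def IsCore {𝒰 T : Type*} (S : Set 𝒰 → T) (σ : T) (C : Set 𝒰) : Prop :=
  S C = σ ∧ ∀ C' : Set 𝒰, C' ⊂ C → S C' ≠ σ

theorem exists_isCore_subset {𝒰 T : Type*} [Finite 𝒰] (S : Set 𝒰 → T) (U : Set 𝒰) :
    ∃ C : Set 𝒰, IsCore S (S U) C ∧ C ⊆ U := by
  obtain ⟨C, hCU, hC⟩ :=
    (Set.toFinite {A : Set 𝒰 | S A = S U}).exists_le_minimal (a := U) rfl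
  exact ⟨C, ⟨hC.prop, fun _ hC' h => hC'.not_subset (hC.le_of_le h hC'.subset)⟩, hCU⟩

theorem Composable.map_maxSet {𝒰 T : Type*} [Finite 𝒰] {S : Set 𝒰 → T}
    (hS : Composable S) {σ : T} (hσ : σ ∈ Set.range S) : S (MaxSet S σ) = σ := by
  obtain ⟨op, hop⟩ := hS
  obtain ⟨M, hM⟩ := (Set.toFinite {A : Set 𝒰 | S A = σ}).exists_maximal hσ
  have hM_eq : S M = σ := hM.prop
  suffices h : MaxSet S σ = M by rw [h, hM_eq]
  refine (Set.sUnion_subset fun B hB => ?_).antisymm (Set.subset_sUnion_of_mem hM_eq)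
  have hB_eq : S B = σ := hB
  have hMB : S (M ∪ B) = σ := by
    rw [hop, hB_eq, ← hM_eq, ← hop, Set.union_self]
  exact Set.subset_union_right.trans (hM.le_of_ge hMB Set.subset_union_left)

theorem Composable.map_eq_of_subset_of_subset {𝒰 T : Type*} {S : Set 𝒰 → T}
    (hS : Composable S) {A U B : Set 𝒰} (hAU : A ⊆ U) (hUB : U ⊆ B) (h : S A = S B) :
    S U = S B := by
  obtain ⟨op, hop⟩ := hS
  calc
    S U = S (U ∪ A) := by rw [Set.union_eq_left.mpr hAU]
    _ = S (U ∪ B) := by rw [hop, h, ← hop]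
    _ = S B := by rw [Set.union_eq_right.mpr hUB]

/-- Characterization: for `σ` in the image of `S`, a set `U` has sketch `σ`
iff it contains a core of `σ` and is contained in `MaxSet σ`.  In particular,
every set contains a core of its own sketch. -/
theorem stmt3 {𝒰 T : Type*} [Fintype 𝒰] (S : Set 𝒰 → T) (hS : Composable S)
    (σ : T) (hσ : σ ∈ Set.range S) :
    (∀ U : Set 𝒰, S U = σ ↔ ∃ C : Set 𝒰, IsCore S σ C ∧ C ⊆ U ∧ U ⊆ MaxSet S σ) ∧
    (∀ U : Set 𝒰, ∃ C : Set 𝒰, IsCore S (S U) C ∧ C ⊆ U) := by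
  refine ⟨fun U => ⟨?_, ?_⟩, exists_isCore_subset S⟩
  · rintro rfl
    obtain ⟨C, hC, hCU⟩ := exists_isCore_subset S U
    exact ⟨C, hC, hCU, Set.subset_sUnion_of_mem rfl⟩
  · rintro ⟨C, hC, hCU, hUM⟩
    have hM := hS.map_maxSet hσ
    rw [hS.map_eq_of_subset_of_subset hCU hUM (hC.1.trans hM.symm), hM]
end

section
/- Let 𝒰 be a finite set and let S : Set 𝒰 → Σ be a composable sketching map, and let C ⊆ 𝒰 be a core of some sketch value σ in the image of S. Then the restriction of S to subsets of C is injective: distinct subsets U₁, U₂ ⊆ C satisfy S(U₁) ≠ S(U₂). Consequently, if the image of S has cardinality at most 2^k, then every core of every sketch value has size at most k. -/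
/-- If `C` is a core of a composable sketching map, then two subsets of `C` with the same
sketch are contained in one another. -/
theorem IsCore.subset_of_eq {𝒰 T : Type*} {S : Set 𝒰 → T} (hS : Composable S) {σ : T}
    {C : Set 𝒰} (hC : IsCore S σ C) {U V : Set 𝒰} (hU : U ⊆ C) (hV : V ⊆ C)
    (h : S U = S V) : U ⊆ V := by
  obtain ⟨op, hop⟩ := hS
  by_contra hUV
  obtain ⟨x, hxU, hxV⟩ := Set.not_subset.mp hUV
  refine hC.2 (V ∪ C \ U) ?_ ?_
  · refine ⟨Set.union_subset hV Set.sdiff_subset, fun hsub => ?_⟩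
    rcases hsub (hU hxU) with hx | hx
    · exact hxV hx
    · exact hx.2 hxU
  · rw [hop, ← h, ← hop, Set.union_sdiff_cancel hU, hC.1]

/-- A composable sketching map is injective on the subsets of a core. -/
theorem IsCore.injOn_powerset {𝒰 T : Type*} {S : Set 𝒰 → T} (hS : Composable S) {σ : T}
    {C : Set 𝒰} (hC : IsCore S σ C) : Set.InjOn S (𝒫 C) := fun _ hU _ hV h =>
  (hC.subset_of_eq hS hU hV h).antisymm (hC.subset_of_eq hS hV hU h.symm)

/-- The restriction of a composable sketching map to subsets of a core is
injective; consequently, if the image of `S` has at most `2 ^ k` elements then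
every core of every sketch value has size at most `k`. -/
theorem stmt4 {𝒰 T : Type*} [Fintype 𝒰] (S : Set 𝒰 → T) (hS : Composable S)
    (σ : T) (hσ : σ ∈ Set.range S) (C : Set 𝒰) (hC : IsCore S σ C) :
    (∀ U₁ U₂ : Set 𝒰, U₁ ⊆ C → U₂ ⊆ C → U₁ ≠ U₂ → S U₁ ≠ S U₂) ∧
    (∀ k : ℕ, Nat.card (Set.range S) ≤ 2 ^ k →
      ∀ τ ∈ Set.range S, ∀ D : Set 𝒰, IsCore S τ D → D.ncard ≤ k) := by
  refine ⟨fun U₁ U₂ h₁ h₂ hne h => hne (hC.injOn_powerset hS h₁ h₂ h), ?_⟩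
  intro k hk τ _ D hD
  have hcard : 2 ^ D.ncard ≤ 2 ^ k :=
    calc 2 ^ D.ncard = (𝒫 D).ncard := (Set.ncard_powerset D).symm
      _ = (S '' 𝒫 D).ncard := (hD.injOn_powerset hS).ncard_image.symm
      _ ≤ (Set.range S).ncard :=
        Set.ncard_le_ncard (Set.image_subset_range S _) (Set.finite_range S)
      _ ≤ 2 ^ k := hk
  exact (Nat.pow_le_pow_iff_right one_lt_two).mp hcard
end

section
/- Let 𝒰 be a finite set, let S : Set 𝒰 → Σ be a composable sketching map, and let A, B ⊆ 𝒰 be disjoint sets such that every C ∈ InCores(A ∪ B) satisfies A ⊆ C. Then for every A' ⊆ A and B' ⊆ B, every C ∈ InCores(A' ∪ B') satisfies A' ⊆ C. -/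
/-- `InCores S U` is the collection of cores of `S U` that are contained in `U`. -/
def InCores {𝒰 T : Type*} (S : Set 𝒰 → T) (U : Set 𝒰) : Set (Set 𝒰) :=
  {C : Set 𝒰 | IsCore S (S U) C ∧ C ⊆ U}

/-- On a finite ground set, every set contains an in-core of its sketch. -/
theorem exists_mem_inCores {𝒰 T : Type*} [Finite 𝒰] (S : Set 𝒰 → T) (U : Set 𝒰) :
    ∃ C, C ∈ InCores S U := by
  obtain ⟨C, hCU, hC⟩ :=
    (Set.toFinite {C : Set 𝒰 | S C = S U}).exists_le_minimal (a := U) rfl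
  exact ⟨C, ⟨hC.prop, fun C' hC' h => hC.not_prop_of_lt hC' h⟩, hCU⟩

/-- Core inheritance: if every in-core of `A ∪ B` contains `A`, then for all
`A' ⊆ A` and `B' ⊆ B`, every in-core of `A' ∪ B'` contains `A'`. -/
theorem stmt9 {𝒰 T : Type*} [Fintype 𝒰] (S : Set 𝒰 → T) (hS : Composable S)
    (A B : Set 𝒰) (hdisj : Disjoint A B)
    (hAB : ∀ C ∈ InCores S (A ∪ B), A ⊆ C) :
    ∀ A' B' : Set 𝒰, A' ⊆ A → B' ⊆ B →
      ∀ C ∈ InCores S (A' ∪ B'), A' ⊆ C := by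
  intro A' B' hA' hB' C hC a haA'
  by_contra haC
  obtain ⟨⟨hCS, -⟩, hCU⟩ := hC
  obtain ⟨op, hop⟩ := hS
  have hD : S (C ∪ (A \ A' ∪ B)) = S (A ∪ B) := by
    rw [hop, hCS, ← hop]
    congr 1
    ext x
    have hA := @hA' x
    have hB := @hB' x
    simp only [Set.mem_union, Set.mem_sdiff]
    tauto
  obtain ⟨E, ⟨hES, hEmin⟩, hED⟩ := exists_mem_inCores S (C ∪ (A \ A' ∪ B))
  rw [hD] at hES hEmin
  have hDU : C ∪ (A \ A' ∪ B) ⊆ A ∪ B :=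
    Set.union_subset (hCU.trans (Set.union_subset_union hA' hB'))
      (Set.union_subset_union_left B Set.sdiff_subset)
  have haE : a ∈ E := hAB E ⟨⟨hES, hEmin⟩, hED.trans hDU⟩ (hA' haA')
  rcases hED haE with h | h | h
  · exact haC h
  · exact h.2 haA'
  · exact Set.disjoint_left.mp hdisj (hA' haA') h
end

section
/- Let 𝒰 be a finite set and let S : Set 𝒰 → Σ be a composable sketching map. Let Q', R, A ⊆ 𝒰 be such that A ∈ InCores(A ∪ R) and S(Q') ≠ S(Q' ∪ R). Then there exists a nonempty subset A' ⊆ A such that S(Q' ∪ A') = S(Q' ∪ R ∪ A) and every D ∈ InCores(Q' ∪ A') satisfies A' ⊆ D. -/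
/-- Sets with equal sketches have equal sketches after adjoining a common set on the left. -/
theorem Composable.union_left_congr {𝒰 T : Type*} {S : Set 𝒰 → T} (hS : Composable S)
    {U V : Set 𝒰} (h : S U = S V) (W : Set 𝒰) : S (W ∪ U) = S (W ∪ V) := by
  obtain ⟨op, hop⟩ := hS
  rw [hop, hop, h]

/-- Deterministic content of the yield lemma: if `A ∈ InCores (A ∪ R)` and
`S Q' ≠ S (Q' ∪ R)`, then there is a nonempty `A' ⊆ A` with
`S (Q' ∪ A') = S (Q' ∪ R ∪ A)` such that every in-core of `Q' ∪ A'`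
contains `A'`. -/
theorem stmt10 {𝒰 T : Type*} [Fintype 𝒰] (S : Set 𝒰 → T) (hS : Composable S)
    (Q' R A : Set 𝒰) (hA : A ∈ InCores S (A ∪ R)) (hne : S Q' ≠ S (Q' ∪ R)) :
    ∃ A' : Set 𝒰, A'.Nonempty ∧ A' ⊆ A ∧ S (Q' ∪ A') = S (Q' ∪ R ∪ A) ∧
      ∀ D ∈ InCores S (Q' ∪ A'), A' ⊆ D := by
  obtain ⟨⟨hAS, -⟩, -⟩ := hA
  have hQA : S (Q' ∪ A) = S (Q' ∪ R ∪ A) := by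
    rw [hS.union_left_congr hAS Q', Set.union_comm A R, Set.union_assoc]
  obtain ⟨A', hA'A, hmin⟩ :=
    (Set.toFinite {B : Set 𝒰 | S (Q' ∪ B) = S (Q' ∪ R ∪ A)}).exists_le_minimal hQA
  have hA' : S (Q' ∪ A') = S (Q' ∪ R ∪ A) := hmin.prop
  refine ⟨A', ?_, hA'A, hA', ?_⟩
  · rw [Set.nonempty_iff_ne_empty]
    rintro rfl
    rw [Set.union_empty] at hA'
    apply hne
    have h := hS.union_left_congr hA' R
    have habs : R ∪ (Q' ∪ R ∪ A) = Q' ∪ R ∪ A := by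
      rw [Set.union_eq_right]
      exact fun x hx => Or.inl (Or.inr hx)
    rw [habs, Set.union_comm R Q'] at h
    exact hA'.trans h.symm
  · rintro D ⟨⟨hD, -⟩, hDsub⟩
    have hset : Q' ∪ D ∩ A' = Q' ∪ D := by
      rw [Set.union_inter_distrib_left, Set.inter_eq_left]
      exact Set.union_subset Set.subset_union_left hDsub
    have hDA : S (Q' ∪ D ∩ A') = S (Q' ∪ R ∪ A) := by
      rw [hset, hS.union_left_congr hD Q', ← Set.union_assoc, Set.union_self, hA']
    exact (hmin.le_of_le hDA Set.inter_subset_right).trans Set.inter_subset_left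
end

section
/- For all integers ℓ ≥ 2 and m with 1 ≤ m ≤ ℓ − 1, and all real numbers a and b: ∫₀¹ (a·q + b) · (m/ℓ − q) · C(ℓ,m) · q^{m−1} · (1−q)^{ℓ−m−1} dq = −a / (ℓ(ℓ+1)), where C(ℓ,m) denotes the binomial coefficient ℓ choose m. -/
theorem integral_pow_succ_mul_one_sub_pow_succ_rec (i j : ℕ) :
    ((i : ℝ) + 1) * ∫ q in (0:ℝ)..1, q ^ i * (1 - q) ^ (j + 1) =
      ((j : ℝ) + 1) * ∫ q in (0:ℝ)..1, q ^ (i + 1) * (1 - q) ^ j := by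
  have hd : ∀ q ∈ Set.uIcc (0:ℝ) 1, HasDerivAt (fun q : ℝ => q ^ (i + 1) * (1 - q) ^ (j + 1))
      (((i : ℝ) + 1) * (q ^ i * (1 - q) ^ (j + 1)) -
        ((j : ℝ) + 1) * (q ^ (i + 1) * (1 - q) ^ j)) q := by
    intro q _
    have h := ((hasDerivAt_id' q).pow (i + 1)).mul
      (((hasDerivAt_id' q).const_sub 1).pow (j + 1))
    refine h.congr_deriv ?_
    simp only [Pi.pow_apply, Nat.add_sub_cancel, Nat.cast_add, Nat.cast_one]
    ring
  have h := intervalIntegral.integral_eq_sub_of_hasDerivAt hd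
    (Continuous.intervalIntegrable (by fun_prop) _ _)
  rw [intervalIntegral.integral_sub (Continuous.intervalIntegrable (by fun_prop) _ _)
    (Continuous.intervalIntegrable (by fun_prop) _ _), intervalIntegral.integral_const_mul,
    intervalIntegral.integral_const_mul] at h
  simp at h
  linarith

theorem factorial_mul_integral_pow_mul_one_sub_pow (i j : ℕ) :
    ((i + j + 1).factorial : ℝ) * ∫ q in (0:ℝ)..1, q ^ i * (1 - q) ^ j =
      (i.factorial : ℝ) * (j.factorial : ℝ) := by
  induction j generalizing i with
  | zero =>
    have : (i : ℝ) + 1 ≠ 0 := by positivity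
    simp [Nat.factorial_succ]
    field_simp
  | succ j ih =>
    have h := integral_pow_succ_mul_one_sub_pow_succ_rec i j
    have h' := ih (i + 1)
    have hi : (i : ℝ) + 1 ≠ 0 := by positivity
    rw [show i + 1 + j + 1 = i + (j + 1) + 1 by ring] at h'
    apply mul_left_cancel₀ hi
    rw [mul_left_comm, h, mul_left_comm, h', Nat.factorial_succ i, Nat.factorial_succ j]
    push_cast
    ring

/-- The beta-integral identity used in the attack analysis: for integers
`2 ≤ ℓ` and `1 ≤ m ≤ ℓ − 1` and reals `a b`,
`∫₀¹ (a·q + b)(m/ℓ − q) C(ℓ,m) q^{m−1} (1−q)^{ℓ−m−1} dq = −a/(ℓ(ℓ+1))`. -/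
theorem stmt19 (ℓ m : ℕ) (hℓ : 2 ≤ ℓ) (hm1 : 1 ≤ m) (hm2 : m ≤ ℓ - 1) (a b : ℝ) :
    ∫ q in (0:ℝ)..1,
        (a * q + b) * ((m : ℝ) / (ℓ : ℝ) - q) * (ℓ.choose m : ℝ) *
          q ^ (m - 1) * (1 - q) ^ (ℓ - m - 1) =
      -a / ((ℓ : ℝ) * ((ℓ : ℝ) + 1)) := by
  obtain ⟨i, rfl⟩ : ∃ i, m = i + 1 := ⟨m - 1, by omega⟩
  obtain ⟨j, rfl⟩ : ∃ j, ℓ = (i + 1) + (j + 1) := ⟨ℓ - i - 2, by omega⟩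
  rw [show i + 1 + (j + 1) - (i + 1) - 1 = j by omega, Nat.add_sub_cancel]
  set C : ℝ := ((i + 1 + (j + 1)).choose (i + 1) : ℝ) with hC
  have hl : ((i + 1 + (j + 1) : ℕ) : ℝ) ≠ 0 := by positivity
  have hd : ∀ q ∈ Set.uIcc (0:ℝ) 1, HasDerivAt
      (fun q : ℝ => C / ((i + 1 + (j + 1) : ℕ) : ℝ) *
        ((a * q + b) * (q ^ (i + 1) * (1 - q) ^ (j + 1))))
      ((a * q + b) * (((i + 1 : ℕ) : ℝ) / ((i + 1 + (j + 1) : ℕ) : ℝ) - q) * C *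
        q ^ i * (1 - q) ^ j +
        C / ((i + 1 + (j + 1) : ℕ) : ℝ) * a * (q ^ (i + 1) * (1 - q) ^ (j + 1))) q := by
    intro q _
    have h := ((((hasDerivAt_id' q).const_mul a).add_const b).mul
      (((hasDerivAt_id' q).pow (i + 1)).mul
        (((hasDerivAt_id' q).const_sub 1).pow (j + 1)))).const_mul
          (C / ((i + 1 + (j + 1) : ℕ) : ℝ))
    refine h.congr_deriv ?_
    simp only [Pi.pow_apply, Pi.mul_apply, Nat.add_sub_cancel]
    field_simp
    push_cast
    ring
  have h := intervalIntegral.integral_eq_sub_of_hasDerivAt hd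
    (Continuous.intervalIntegrable (by fun_prop) _ _)
  rw [intervalIntegral.integral_add (Continuous.intervalIntegrable (by fun_prop) _ _)
    (Continuous.intervalIntegrable (by fun_prop) _ _), intervalIntegral.integral_const_mul] at h
  have hB := factorial_mul_integral_pow_mul_one_sub_pow (i + 1) (j + 1)
  have hF : C * ((i + 1).factorial : ℝ) * ((j + 1).factorial : ℝ) =
      ((i + 1 + (j + 1)).factorial : ℝ) := by
    rw [hC]
    have := Nat.choose_mul_factorial_mul_factorial (Nat.le_add_right (i + 1) (j + 1))
    rw [Nat.add_sub_cancel_left] at this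
    exact_mod_cast this
  rw [Nat.factorial_succ (i + 1 + (j + 1)), Nat.cast_mul, Nat.cast_succ] at hB
  have hN : ((i + 1 + (j + 1)).factorial : ℝ) ≠ 0 := by positivity
  have hl' : ((i + 1 + (j + 1) : ℕ) : ℝ) + 1 ≠ 0 := by positivity
  have hCB : (((i + 1 + (j + 1) : ℕ) : ℝ) + 1) *
      (C * ∫ q in (0:ℝ)..1, q ^ (i + 1) * (1 - q) ^ (j + 1)) = 1 := by
    apply mul_left_cancel₀ hN
    linear_combination C * hB + hF
  have hz : ∀ x y : ℝ, C / y * ((a * 1 + b) * (1 ^ (i + 1) * (1 - 1) ^ (j + 1))) -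
      C / y * ((a * 0 + b) * (0 ^ (i + 1) * x)) = 0 := by
    intro x y
    simp
  rw [hz] at h
  rw [eq_neg_of_add_eq_zero_left h]
  field_simp
  linear_combination -a * hCB
end
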